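/- (Extended Routh–Hurwitz criterion) Let p(z) = b₀zⁿ + ⋯ + b_n be a real polynomial of degree n with positive leading coefficient b₀ > 0, and suppose the number zero is a root of p with multiplicity n₀, where 0 ≤ n₀ < n (multiplicity zero meaning 0 is not a root). Then every nonzero complex root of p has negative real part if and only if the Hurwitz determinants of p with indexes from 1 to n−n₀ are positive: Δ_k > 0 for all k = 1, …, n−n₀. -/

import Mathlib

/-- The `k`-th Hurwitz determinant of a real polynomial `p` of degree `n`:
the determinant of the `k × k` matrix whose `(i, j)` entry (1-based indices)
is `b_{2j - i}`, where `b_m` is the coefficient of `z^(n - m)` in `p`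
(with the convention `b_m = 0` for `m < 0` or `m > n`). -/
noncomputable def hurwitzDet (p : Polynomial ℝ) (k : ℕ) : ℝ :=
  Matrix.det (Matrix.of fun i j : Fin k =>
    if 0 ≤ 2 * (j : ℤ) - (i : ℤ) + 1 ∧ 2 * (j : ℤ) - (i : ℤ) + 1 ≤ (p.natDegree : ℤ)
    then p.coeff (p.natDegree - (2 * (j : ℤ) - (i : ℤ) + 1).toNat)
    else 0)

namespace RouthHurwitz

open Polynomial

open ComplexConjugate in
/-- A Cauchy–Schwarz inequality for the finite Blaschke product `∏ (z + conj a) / (z - a)` of the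
right half-plane, between its reproducing kernel at `z` and at infinity. -/
theorem kernel_ineq (s : Multiset ℂ) (hs : ∀ a ∈ s, a.re < 0) (z : ℂ) (hz : 0 ≤ z.re) :
    0 ≤ -s.sum.re ∧
    Complex.normSq (s.map fun a => z + conj a).prod ≤ Complex.normSq (s.map fun a => z - a).prod ∧
    z.re * Complex.normSq ((s.map fun a => z - a).prod - (s.map fun a => z + conj a).prod) ≤
      -s.sum.re * (Complex.normSq (s.map fun a => z - a).prod -
        Complex.normSq (s.map fun a => z + conj a).prod) := by
  induction s using Multiset.induction with
  | empty => simp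
  | cons a s ih =>
    obtain ⟨h0, h1, h2⟩ := ih fun b hb => hs b (Multiset.mem_cons_of_mem hb)
    have ha := hs a (Multiset.mem_cons_self a s)
    simp only [Multiset.map_cons, Multiset.prod_cons, Multiset.sum_cons, Complex.add_re]
    generalize (s.map fun a => z - a).prod = Q at *
    generalize (s.map fun a => z + conj a).prod = R at *
    generalize s.sum.re = S at *
    obtain ⟨α, hα⟩ : ∃ α, α = -a.re := ⟨_, rfl⟩
    have e1 : (z - a) * Q - (z + conj a) * R = (z - a) * (Q - R) + (2 * α : ℝ) * R := by
      apply Complex.ext <;> simp [hα] <;> ring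
    have e2 : Complex.normSq (z + conj a) = Complex.normSq (z - a) - 4 * α * z.re := by
      simp [Complex.normSq_apply, hα]; ring
    have hα0 : 0 < α := by linarith
    have hN := Complex.normSq_nonneg (z - a)
    have hR := Complex.normSq_nonneg R
    have tri : Complex.normSq ((z - a) * (Q - R) + (2 * α : ℝ) * R) ≤
        (‖z - a‖ * ‖Q - R‖ + 2 * α * ‖R‖) ^ 2 := by
      rw [Complex.normSq_eq_norm_sq]
      gcongr
      refine (norm_add_le _ _).trans ?_
      simp [abs_of_pos hα0]
    rw [e1]
    simp only [Complex.normSq_mul, e2]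
    refine ⟨by linarith, ?_, ?_⟩
    · nlinarith [mul_nonneg (mul_nonneg hα0.le hz) hR, mul_le_mul_of_nonneg_left h1 hN]
    · refine (mul_le_mul_of_nonneg_left tri hz).trans ?_
      simp only [Complex.normSq_eq_norm_sq] at *
      have ea : a.re = -α := by linarith
      obtain ⟨T, rfl⟩ : ∃ T, S = -T := ⟨-S, by ring⟩
      rw [ea]
      have hu := norm_nonneg (z - a)
      have hd := norm_nonneg (Q - R)
      have hr := norm_nonneg R
      generalize ‖z - a‖ = u at *
      generalize ‖Q - R‖ = d at *
      generalize ‖R‖ = r at *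
      generalize ‖Q‖ = q at *
      generalize z.re = x at *
      obtain ⟨W, hW⟩ : ∃ W, W = q ^ 2 - r ^ 2 := ⟨_, rfl⟩
      have hq : q ^ 2 = W + r ^ 2 := by linarith
      rw [hq] at h1 h2 ⊢
      simp only [neg_neg, add_sub_cancel_right] at *
      have hW0 : 0 ≤ W := by linarith
      have hT : 0 ≤ T := by linarith
      have key : 4 * x * (u * d) * r ≤ u ^ 2 * W + 4 * x * T * r ^ 2 := by
        rcases hT.eq_or_lt with h | h
        · subst h
          have : x * d = 0 := by
            have : x * d ^ 2 = 0 := le_antisymm (by linarith) (by positivity)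
            rcases mul_eq_zero.1 this with h | h
            · simp [h]
            · simp [pow_eq_zero_iff] at h; simp [h]
          have : 4 * x * (u * d) * r = 0 := by linear_combination 4 * u * r * this
          rw [this]; positivity
        · refine le_of_mul_le_mul_left ?_ h
          nlinarith [mul_le_mul_of_nonneg_left h2 (sq_nonneg u),
            mul_nonneg hz (sq_nonneg (u * d - 2 * T * r))]
      nlinarith [mul_le_mul_of_nonneg_left h2 (sq_nonneg u), mul_le_mul_of_nonneg_left key hα0.le]

/-- A sequence version of the Hurwitz determinant. -/
noncomputable def seqDet (b : ℤ → ℝ) (k : ℕ) : ℝ :=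
  Matrix.det (Matrix.of fun i j : Fin k => b (2 * (j : ℤ) - (i : ℤ) + 1))

theorem seqDet_succ (b : ℤ → ℝ) (hb : ∀ j < 0, b j = 0) (h1 : b 1 ≠ 0) (k : ℕ) :
    seqDet b (k + 1) = b 1 *
      seqDet (fun j => b (j + 1) - if Odd j then b 0 / b 1 * b (j + 2) else 0) k := by
  have h := Matrix.det_eq_of_forall_row_eq_smul_add_pred
    (A := Matrix.of fun i j : Fin (k + 1) => b (2 * (j : ℤ) - (i : ℤ) + 1))
    (B := Matrix.of fun i j : Fin (k + 1) => b (2 * (j : ℤ) - (i : ℤ) + 1) -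
      if Odd (i : ℤ) then b 0 / b 1 * b (2 * (j : ℤ) - (i : ℤ) + 2) else 0)
    (fun i => if Even (i : ℤ) then b 0 / b 1 else 0) (by simp) (by
      intro i j
      simp only [Matrix.of_apply, Fin.val_succ, Fin.val_castSucc, Nat.cast_add, Nat.cast_one,
        ← Int.not_even_iff_odd, Int.even_add_one, not_not]
      rw [show 2 * (j : ℤ) - (i + 1) + 2 = 2 * (j : ℤ) - i + 1 by ring]
      split_ifs <;> ring)
  rw [seqDet, h, Matrix.det_succ_column_zero, Fin.sum_univ_succ, Finset.sum_eq_zero, add_zero]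
  · simp only [Matrix.of_apply, Fin.val_zero, seqDet]
    simp only [Nat.cast_zero, pow_zero, one_mul]
    congr 1
    · simp
    · congr 1
      ext i j
      simp only [Matrix.submatrix_apply, Matrix.of_apply, Fin.succAbove_zero, Fin.val_succ,
        Nat.cast_add, Nat.cast_one]
      have : Odd ((i : ℤ) + 1) ↔ Odd (2 * (j : ℤ) - i + 1) := by
        simp [Int.even_sub, parity_simps]
      simp only [this]
      rw [show 2 * ((j : ℤ) + 1) - (i + 1) + 1 = 2 * (j : ℤ) - i + 1 + 1 by ring,
        show 2 * ((j : ℤ) + 1) - (i + 1) + 2 = 2 * (j : ℤ) - i + 1 + 2 by ring]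
  · intro i _
    have : b (2 * ((0 : Fin (k + 1)) : ℕ) - ((i.succ : Fin (k + 1)) : ℕ) + 1) -
      (if Odd (((i.succ : Fin (k + 1)) : ℕ) : ℤ) then
        b 0 / b 1 * b (2 * ((0 : Fin (k + 1)) : ℕ) - ((i.succ : Fin (k + 1)) : ℕ) + 2) else 0)
        = 0 := by
      simp only [Fin.val_zero, Fin.val_succ, Nat.cast_add, Nat.cast_one, Nat.cast_zero]
      rcases Nat.eq_zero_or_pos (i : ℕ) with h | h
      · simp [h, h1]
      · rw [hb _ (by omega)]
        rcases (show (i : ℕ) = 1 ∨ 1 < (i : ℕ) by omega) with h' | h'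
        · simp [h', Int.odd_iff]
        · rw [hb (2 * 0 - ((i : ℤ) + 1) + 2) (by omega)]; simp
    simp only [Matrix.of_apply, this]
    simp

/-- The coefficients of `p`, listed from the leading one and extended by zero. -/
noncomputable def revCoeff (p : ℝ[X]) (j : ℤ) : ℝ :=
  if 0 ≤ j ∧ j ≤ (p.natDegree : ℤ) then p.coeff (p.natDegree - j.toNat) else 0

theorem seqDet_revCoeff (p : ℝ[X]) (k : ℕ) : seqDet (revCoeff p) k = hurwitzDet p k := rfl

/-- The part of `p` consisting of the terms whose degree differs in parity from that of `p`. -/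
noncomputable def offParityPart (p : ℝ[X]) : ℝ[X] :=
  C (1 / 2) * (p - C ((-1) ^ p.natDegree) * p.comp (-X))

theorem coeff_offParityPart (p : ℝ[X]) (i : ℕ) :
    (offParityPart p).coeff i = if Odd (p.natDegree + i) then p.coeff i else 0 := by
  have h : (p.comp (-X)).coeff i = (-1) ^ i * p.coeff i := by
    rw [show (-X : ℝ[X]) = C (-1) * X by simp, comp_C_mul_X_coeff, mul_comm]
  rw [offParityPart, coeff_C_mul, coeff_sub, coeff_C_mul, h, ← mul_assoc, ← pow_add]
  split_ifs with ho
  · rw [ho.neg_one_pow]; ring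
  · rw [(Nat.not_odd_iff_even.1 ho).neg_one_pow]; ring

/-- One step of the Routh algorithm. -/
noncomputable def routhStep (p : ℝ[X]) : ℝ[X] :=
  p - C (revCoeff p 0 / revCoeff p 1) * (X * offParityPart p)

theorem revCoeff_zero (p : ℝ[X]) : revCoeff p 0 = p.leadingCoeff := by
  simp [revCoeff]

theorem revCoeff_of_neg (p : ℝ[X]) (j : ℤ) (hj : j < 0) : revCoeff p j = 0 := by
  simp [revCoeff, hj]

theorem revCoeff_eq_coeff (p : ℝ[X]) (j : ℤ) (i : ℕ) (h : j + i = p.natDegree) :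
    revCoeff p j = p.coeff i := by
  unfold revCoeff
  split_ifs with hj
  · congr 1; omega
  · rw [coeff_eq_zero_of_natDegree_lt]; omega

theorem coeff_routhStep (p : ℝ[X]) (j : ℤ) (i : ℕ)
    (h : j + i + 1 = p.natDegree) :
    (routhStep p).coeff i = revCoeff p (j + 1) -
      if Odd j then revCoeff p 0 / revCoeff p 1 * revCoeff p (j + 2) else 0 := by
  rw [routhStep, coeff_sub, coeff_C_mul, revCoeff_eq_coeff p (j + 1) i (by omega)]
  congr 1
  rcases i with _ | i
  · have : revCoeff p (j + 2) = 0 := by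
      rw [revCoeff, if_neg]; push_cast at h; omega
    simp [this]
  · rw [coeff_X_mul, coeff_offParityPart, revCoeff_eq_coeff p (j + 2) i (by push_cast at h; omega)]
    have : Odd (p.natDegree + i) ↔ Odd j := by
      rw [Nat.odd_iff, Int.odd_iff]; push_cast at h; omega
    simp only [this]
    split_ifs <;> simp

theorem natDegree_routhStep (p : ℝ[X]) (h1 : revCoeff p 1 ≠ 0) (m : ℕ)
    (hm : p.natDegree = m + 1) : (routhStep p).natDegree = m := by
  refine le_antisymm (natDegree_le_iff_coeff_eq_zero.2 fun N hN => ?_) ?_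
  · rw [coeff_routhStep p (m - N) N (by rw [hm]; push_cast; ring)]
    rcases (show N = m + 1 ∨ m + 1 < N by omega) with rfl | hN
    · simp [h1]
    · rw [revCoeff_of_neg p (m - N + 1) (by omega)]
      rcases (show N = m + 2 ∨ m + 2 < N by omega) with rfl | hN
      · simp [Int.odd_iff]
      · rw [revCoeff_of_neg p (m - N + 2) (by omega)]; simp
  · refine le_natDegree_of_ne_zero ?_
    rw [coeff_routhStep p 0 m (by rw [hm]; push_cast; ring)]
    simpa using h1

theorem revCoeff_routhStep (p : ℝ[X]) (h1 : revCoeff p 1 ≠ 0) (m : ℕ)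
    (hm : p.natDegree = m + 1) (j : ℤ) :
    revCoeff (routhStep p) j = revCoeff p (j + 1) -
      if Odd j then revCoeff p 0 / revCoeff p 1 * revCoeff p (j + 2) else 0 := by
  by_cases hj : j ≤ m
  · obtain ⟨i, hi⟩ : ∃ i : ℕ, j + i = m := ⟨(m - j).toNat, by omega⟩
    rw [← coeff_routhStep p j i (by omega), revCoeff_eq_coeff _ j i]
    rw [natDegree_routhStep p h1 m hm, hi]
  · rw [revCoeff, if_neg, revCoeff, if_neg, revCoeff, revCoeff, revCoeff, if_neg (c := _ ∧ j + 2 ≤ _)]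
    · simp
    all_goals simp only [natDegree_routhStep p h1 m hm, hm]; push_cast; omega

theorem hurwitzDet_succ (p : ℝ[X]) (h1 : revCoeff p 1 ≠ 0) (m : ℕ)
    (hm : p.natDegree = m + 1) (k : ℕ) :
    hurwitzDet p (k + 1) = revCoeff p 1 * hurwitzDet (routhStep p) k := by
  rw [← seqDet_revCoeff, seqDet_succ _ (revCoeff_of_neg p) h1, ← seqDet_revCoeff]
  congr 2
  ext j
  rw [revCoeff_routhStep p h1 m hm]


/-- The complex roots of a real polynomial, its factorization and the real part of Vieta's formula
for the sum of the roots. -/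
theorem exists_complex_roots (p : ℝ[X]) : ∃ s : Multiset ℂ,
    s.card = p.natDegree ∧ (∀ a ∈ s, aeval a p = 0) ∧
    p.nextCoeff = -p.leadingCoeff * s.sum.re ∧
    ∀ w : ℂ, aeval w p = p.leadingCoeff * (s.map fun a => w - a).prod := by
  have hinj : Function.Injective (algebraMap ℝ ℂ) := (algebraMap ℝ ℂ).injective
  have hsplit := IsAlgClosed.splits (p.map (algebraMap ℝ ℂ))
  refine ⟨(p.map (algebraMap ℝ ℂ)).roots, ?_, fun a ha => ?_, ?_, fun w => ?_⟩
  · rw [← hsplit.natDegree_eq_card_roots, natDegree_map]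
  · simpa [eval_map_algebraMap] using isRoot_of_mem_roots ha
  · have h := hsplit.nextCoeff_eq_neg_sum_roots_mul_leadingCoeff
    rw [nextCoeff_map hinj, leadingCoeff_map_of_injective hinj] at h
    simpa using congrArg Complex.re h
  · have h := congrArg (eval w) hsplit.eq_prod_roots
    rw [leadingCoeff_map_of_injective hinj, eval_mul, eval_C, eval_multiset_prod,
      Multiset.map_map, eval_map_algebraMap] at h
    simpa using h

open ComplexConjugate in
/-- `kernel_ineq` for the roots of a stable real polynomial `p`, where the second product is
`± p (-z)` up to the leading coefficient. -/
theorem aeval_kernel_ineq (p : ℝ[X]) (hp : ∀ z : ℂ, aeval z p = 0 → z.re < 0)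
    (hl : 0 < p.leadingCoeff) (z : ℂ) (hz : 0 ≤ z.re) :
    Complex.normSq ((-1) ^ p.natDegree * aeval (-z) p) ≤ Complex.normSq (aeval z p) ∧
    p.leadingCoeff * z.re * Complex.normSq (aeval z p - (-1) ^ p.natDegree * aeval (-z) p) ≤
      p.nextCoeff * (Complex.normSq (aeval z p) -
        Complex.normSq ((-1) ^ p.natDegree * aeval (-z) p)) := by
  obtain ⟨s, hcard, hroot, hre, hprod⟩ := exists_complex_roots p
  have hneg : (-1) ^ p.natDegree * aeval (-z) p =
      p.leadingCoeff * (s.map fun a => z + conj a).prod := by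
    have h := aeval_conj p (-conj z)
    rw [map_neg, Complex.conj_conj, hprod (-conj z), map_mul, Complex.conj_ofReal,
      map_multiset_prod, Multiset.map_map] at h
    have h' : (s.map (conj ∘ fun a => -conj z - a)) = (s.map fun a => z + conj a).map Neg.neg := by
      rw [Multiset.map_map]
      refine Multiset.map_congr rfl fun a _ => ?_
      simp; ring
    rw [h, h', Multiset.prod_map_neg, Multiset.card_map, hcard, mul_left_comm, ← mul_assoc _ _
      (Multiset.prod _), ← pow_add, Even.neg_one_pow ⟨_, rfl⟩, one_mul]
  obtain ⟨-, h1, h2⟩ := kernel_ineq s (fun a ha => hp a (hroot a ha)) z hz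
  rw [hneg, hprod z, ← mul_sub, hre]
  simp only [Complex.normSq_mul, Complex.normSq_ofReal]
  refine ⟨by gcongr, ?_⟩
  nlinarith [mul_le_mul_of_nonneg_left h2 (pow_pos hl 3).le]

theorem nextCoeff_pos_of_stable (p : ℝ[X]) (hp : ∀ z : ℂ, aeval z p = 0 → z.re < 0)
    (hl : 0 < p.leadingCoeff) (hd : 0 < p.natDegree) : 0 < p.nextCoeff := by
  obtain ⟨s, hcard, hroot, hre, -⟩ := exists_complex_roots p
  have hs : ∀ a ∈ s, a.re < 0 := fun a ha => hp a (hroot a ha)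
  obtain ⟨a, ha⟩ := Multiset.card_pos_iff_exists_mem.1 (hcard ▸ hd)
  obtain ⟨t, rfl⟩ := Multiset.exists_cons_of_mem ha
  have h0 := (kernel_ineq t (fun b hb => hs b (Multiset.mem_cons_of_mem hb)) 0 le_rfl).1
  have h1 := hs a ha
  rw [hre, Multiset.sum_cons, Complex.add_re]
  nlinarith

theorem aeval_routhStep (p : ℝ[X]) (z : ℂ) :
    aeval z (routhStep p) = aeval z p - (revCoeff p 0 / revCoeff p 1 : ℝ) * z *
      ((aeval z p - (-1) ^ p.natDegree * aeval (-z) p) / 2) := by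
  simp [routhStep, offParityPart, aeval_comp]
  ring

theorem revCoeff_one (p : ℝ[X]) (hd : 0 < p.natDegree) : revCoeff p 1 = p.nextCoeff := by
  rw [nextCoeff_of_natDegree_pos hd]
  exact revCoeff_eq_coeff p 1 _ (by omega)

theorem leadingCoeff_routhStep (p : ℝ[X]) (h1 : revCoeff p 1 ≠ 0) (m : ℕ)
    (hm : p.natDegree = m + 1) : (routhStep p).leadingCoeff = revCoeff p 1 := by
  rw [← revCoeff_zero, revCoeff_routhStep p h1 m hm]
  simp

theorem stable_routhStep_iff (p : ℝ[X]) (h0 : 0 < p.leadingCoeff) (h1 : 0 < revCoeff p 1) (m : ℕ)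
    (hm : p.natDegree = m + 1) :
    (∀ z : ℂ, aeval z (routhStep p) = 0 → z.re < 0) ↔ ∀ z : ℂ, aeval z p = 0 → z.re < 0 := by
  have hc : revCoeff p 1 * (revCoeff p 0 / revCoeff p 1) = p.leadingCoeff := by
    rw [revCoeff_zero]; field_simp
  have hc0 : 0 < revCoeff p 0 / revCoeff p 1 := by rw [revCoeff_zero]; positivity
  constructor
  · intro h z hz
    by_contra! hre
    have hk := (aeval_kernel_ineq (routhStep p) h
      (by rwa [leadingCoeff_routhStep p h1.ne' m hm]) z hre).1
    refine absurd ?_ (not_lt.2 hre)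
    refine h z ?_
    have e2 := aeval_routhStep p (-z)
    rw [natDegree_routhStep p h1.ne' m hm, aeval_routhStep p z, e2, neg_neg, hz, hm] at hk
    rw [aeval_routhStep p z, hz, hm]
    generalize revCoeff p 0 / revCoeff p 1 = c at *
    have hs : ((-1 : ℂ) ^ (m + 1)) * (-1) ^ (m + 1) = 1 := by
      rw [← pow_add, Even.neg_one_pow ⟨_, rfl⟩]
    obtain ⟨G, hG⟩ : ∃ G : ℂ, G = (-1) ^ (m + 1) * aeval (-z) p / 2 := ⟨_, rfl⟩
    have ea : aeval (-z) p = (-1) ^ (m + 1) * (2 * G) := by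
      rw [hG]; linear_combination -(aeval (-z) p) * hs
    rw [ea] at hk ⊢
    have hs' : ((-1 : ℂ) ^ m) * (-1) ^ m = 1 := by
      rw [← pow_add, Even.neg_one_pow ⟨_, rfl⟩]
    have k1 : (-1 : ℂ) ^ m * ((-1) ^ (m + 1) * (2 * G) - c * -z *
        (((-1) ^ (m + 1) * (2 * G) - (-1) ^ (m + 1) * 0) / 2)) = -(2 + c * z) * G := by
      linear_combination (-2 * G - c * z * G) * hs'
    have k2 : (0 : ℂ) - c * z * ((0 - (-1) ^ (m + 1) * ((-1) ^ (m + 1) * (2 * G))) / 2) =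
        c * z * G := by
      linear_combination c * z * G * hs
    rw [k1, k2, Complex.normSq_mul, Complex.normSq_mul (c * z) G] at hk
    rw [k2]
    have k3 : Complex.normSq (-(2 + c * z)) = Complex.normSq (c * z) + 4 + 4 * (c * z.re) := by
      simp [Complex.normSq_apply]; ring
    have : Complex.normSq G = 0 := by
      refine le_antisymm ?_ (Complex.normSq_nonneg G)
      nlinarith [mul_nonneg (mul_nonneg hc0.le hre) (Complex.normSq_nonneg G)]
    rw [Complex.normSq_eq_zero.1 this, mul_zero]
  · intro h z hz
    by_contra! hre
    have hk := (aeval_kernel_ineq p h h0 z hre).2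
    refine absurd (h z ?_) (not_lt.2 hre)
    rw [aeval_routhStep p z] at hz
    rw [← revCoeff_one p (by omega), ← hc] at hk
    generalize revCoeff p 0 / revCoeff p 1 = c at *
    generalize aeval z p = Q at *
    generalize (-1) ^ p.natDegree * aeval (-z) p = R at *
    obtain ⟨G, hG⟩ : ∃ G : ℂ, G = (Q - R) / 2 := ⟨_, rfl⟩
    rw [← hG] at hz
    have eQ : Q = c * z * G := by linear_combination hz
    have eR : R = (c * z - 2) * G := by linear_combination hz + 2 * hG
    have k3 : Complex.normSq (c * z - 2) = Complex.normSq (c * z) + 4 - 4 * (c * z.re) := by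
      simp [Complex.normSq_apply]; ring
    have k4 : Q - R = (2 : ℝ) * G := by rw [hG]; push_cast; ring
    rw [k4, eQ, eR, Complex.normSq_mul, Complex.normSq_mul (c * z) G, Complex.normSq_mul _ G, k3,
      Complex.normSq_ofReal] at hk
    have : Complex.normSq G = 0 := by
      refine le_antisymm ?_ (Complex.normSq_nonneg G)
      nlinarith
    rw [eQ, Complex.normSq_eq_zero.1 this, mul_zero]

/-- The Routh–Hurwitz criterion. -/
theorem stable_iff_hurwitzDet_pos (m : ℕ) (p : ℝ[X]) (hl : 0 < p.leadingCoeff)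
    (hm : p.natDegree = m) :
    (∀ z : ℂ, aeval z p = 0 → z.re < 0) ↔
      ∀ k : ℕ, 1 ≤ k → k ≤ m → 0 < hurwitzDet p k := by
  induction m generalizing p with
  | zero =>
    refine iff_of_true (fun z hz => ?_) (fun k h1 h2 => by omega)
    rw [eq_C_of_natDegree_eq_zero hm] at hz hl
    simp at hz hl
    exact absurd hz hl.ne'
  | succ m ih =>
    have hD1 : hurwitzDet p 1 = revCoeff p 1 := by
      rw [← seqDet_revCoeff]; simp [seqDet]
    by_cases h1 : 0 < revCoeff p 1
    · rw [← stable_routhStep_iff p hl h1 m hm, ih (routhStep p)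
        (by rwa [leadingCoeff_routhStep p h1.ne' m hm]) (natDegree_routhStep p h1.ne' m hm)]
      constructor
      · intro h k hk1 hk
        obtain ⟨k, rfl⟩ := Nat.exists_eq_add_of_le' hk1
        rw [hurwitzDet_succ p h1.ne' m hm]
        rcases Nat.eq_zero_or_pos k with rfl | hk0
        · simpa [hurwitzDet] using h1
        · exact mul_pos h1 (h k hk0 (by omega))
      · intro h k hk1 hk
        have := h (k + 1) (by omega) (by omega)
        rw [hurwitzDet_succ p h1.ne' m hm] at this
        exact pos_of_mul_pos_right this h1.le
    · refine iff_of_false (fun h => h1 ?_) (fun h => h1 ?_)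
      · rw [revCoeff_one p (by omega)]
        exact nextCoeff_pos_of_stable p h hl (by omega)
      · rw [← hD1]
        exact h 1 le_rfl (by omega)

theorem revCoeff_X_pow_mul (q : ℝ[X]) (hq : q ≠ 0) (n : ℕ) (j : ℤ) :
    revCoeff (X ^ n * q) j = revCoeff q j := by
  have hd : (X ^ n * q).natDegree = q.natDegree + n := natDegree_X_pow_mul n hq
  by_cases hj : 0 ≤ j
  · by_cases hj' : j ≤ q.natDegree
    · obtain ⟨i, hi⟩ : ∃ i : ℕ, j + i = q.natDegree := ⟨(q.natDegree - j).toNat, by omega⟩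
      rw [revCoeff_eq_coeff q j i hi, revCoeff_eq_coeff _ j (i + n) (by rw [hd]; push_cast; omega),
        coeff_X_pow_mul]
    · rw [revCoeff, revCoeff, if_neg (c := _ ∧ j ≤ (q.natDegree : ℤ)) (by omega), coeff_X_pow_mul']
      split_ifs
      · omega
      · rfl
      · rfl
  · rw [revCoeff_of_neg _ j (by omega), revCoeff_of_neg _ j (by omega)]

end RouthHurwitz

/-- **Extended Routh–Hurwitz criterion.** For a real polynomial of degree `n`
with positive leading coefficient, having `0` as a root of multiplicity
`n₀ < n`, every nonzero complex root has negative real part iff the Hurwitz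
determinants `Δ_1, …, Δ_{n - n₀}` are positive. -/
theorem extended_routh_hurwitz_criterion
    (n n₀ : ℕ) (p : Polynomial ℝ)
    (hdeg : p.degree = n) (hlead : 0 < p.leadingCoeff)
    (hmult : p.rootMultiplicity 0 = n₀) (hn₀ : n₀ < n) :
    (∀ z : ℂ, z ≠ 0 → Polynomial.aeval z p = 0 → z.re < 0) ↔
      (∀ k : ℕ, 1 ≤ k → k ≤ n - n₀ → 0 < hurwitzDet p k) := by
  have hp : p ≠ 0 := fun h => by simp [h] at hlead
  obtain ⟨q, hpq, hq⟩ := Polynomial.exists_eq_pow_rootMultiplicity_mul_and_not_dvd p hp 0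
  rw [hmult, Polynomial.C_0, sub_zero] at hpq
  rw [Polynomial.C_0, sub_zero, Polynomial.X_dvd_iff] at hq
  have hq0 : q ≠ 0 := fun h => hq (by simp [h])
  have hdq : q.natDegree = n - n₀ := by
    have h := Polynomial.natDegree_eq_of_degree_eq_some hdeg
    rw [hpq, Polynomial.natDegree_X_pow_mul _ hq0] at h
    omega
  have hlq : 0 < q.leadingCoeff := by
    rw [hpq] at hlead
    simpa using hlead
  have hdet : ∀ k, hurwitzDet p k = hurwitzDet q k := fun k => by
    rw [← RouthHurwitz.seqDet_revCoeff, ← RouthHurwitz.seqDet_revCoeff]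
    congr 1
    funext j
    rw [hpq, RouthHurwitz.revCoeff_X_pow_mul q hq0]
  simp only [hdet]
  rw [← RouthHurwitz.stable_iff_hurwitzDet_pos _ q hlq hdq]
  constructor
  · intro h z hz
    refine h z ?_ (by rw [hpq]; simp [hz])
    rintro rfl
    refine hq ?_
    have h0 := Polynomial.aeval_algebraMap_apply ℂ (0 : ℝ) q
    rw [map_zero, hz] at h0
    simpa [Polynomial.coeff_zero_eq_eval_zero] using h0.symm
  · intro h z hz hpz
    refine h z ?_
    rw [hpq] at hpz
    simpa [hz] using hpz
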